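/- Fix ς ∈ Ĝ∖G and let (V_i, ρ_i)_{i ∈ I} be a finite family of irreducible θ-twisted representations of G whose characters χ_i form an orthonormal basis, with respect to ⟨f₁,f₂⟩_G = (1/|G|)·Σ_{g∈G} θ(g⁻¹,g)⁻¹·f₁(g⁻¹)·f₂(g), of the space of θ-twisted class functions on G (functions f: G → ℂ with f(hgh⁻¹) = τ(θ)([h]g)·f(g) for all g,h ∈ G). Then, as functions on G, ν = Σ_{i ∈ I, P(V_i) ≅ V_i} ⟨χ_i, ν⟩_G · χ_i, where the sum is over those i for which there exists a G-equivariant linear isomorphism V_i → P(V_i). -/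

import Mathlib

open Module

/-- Orientation-twisted loop transgression coefficient. -/
noncomputable def taurefl {Ghat : Type*} [Group Ghat] (π : Ghat →* ℤˣ)
    (θ : Ghat → Ghat → ℂ) (ω g : Ghat) : ℂ :=
  θ g⁻¹ g ^ ((((π ω : ℤˣ) : ℤ) - 1) / 2) *
    (θ (ω * g ^ ((π ω : ℤˣ) : ℤ) * ω⁻¹) ω / θ ω (g ^ ((π ω : ℤˣ) : ℤ)))

/-- The twisted dual representation `ρ^P(g) = (λ(g)/τ^refl(θ)([ς]g)) ⬝ ρ(ςg⁻¹ς⁻¹)^∨`. -/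
noncomputable def rhoP {Ghat V : Type*} [Group Ghat] [AddCommGroup V] [Module ℂ V]
    (π : Ghat →* ℤˣ) (θ : Ghat → Ghat → ℂ) (lam : Ghat →* ℂ)
    (ρ : Ghat → V ≃ₗ[ℂ] V) (ς g : Ghat) :
    Module.Dual ℂ V →ₗ[ℂ] Module.Dual ℂ V :=
  (lam g / taurefl π θ ς g) • (ρ (ς * g⁻¹ * ς⁻¹)).toLinearMap.dualMap

/-- The character of a twisted representation, as a function on `Ĝ` supported on
`G = ker π`. -/
noncomputable def chiFun {Ghat V : Type*} [Group Ghat] [AddCommGroup V] [Module ℂ V]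
    (π : Ghat →* ℤˣ) (ρ : Ghat → V ≃ₗ[ℂ] V) : Ghat → ℂ :=
  fun g => if π g = 1 then LinearMap.trace ℂ V (ρ g).toLinearMap else 0

/-- The pairing `⟨f₁,f₂⟩_G = (1/|G|) Σ_{g ∈ G} θ(g⁻¹,g)⁻¹ f₁(g⁻¹) f₂(g)`. -/
noncomputable def pairG {Ghat : Type*} [Group Ghat] [Fintype Ghat] [DecidableEq Ghat]
    (π : Ghat →* ℤˣ) (θ : Ghat → Ghat → ℂ) (f₁ f₂ : Ghat → ℂ) : ℂ :=
  (↑(Finset.univ.filter fun g : Ghat => π g = 1).card)⁻¹ *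
    ∑ g ∈ Finset.univ.filter (fun g : Ghat => π g = 1),
      (θ g⁻¹ g)⁻¹ * f₁ g⁻¹ * f₂ g

/-- The twisted Frobenius–Schur element as a function on `G`:
`ν(g) = Σ_{ς' ∈ Ĝ∖G, ς'² = g} λ(ς')/θ(ς',ς')`. -/
noncomputable def nuFun {Ghat : Type*} [Group Ghat] [Fintype Ghat] [DecidableEq Ghat]
    (π : Ghat →* ℤˣ) (θ : Ghat → Ghat → ℂ) (lam : Ghat →* ℂ) : Ghat → ℂ :=
  fun g => ∑ ς' ∈ Finset.univ.filter (fun ω : Ghat => π ω = -1 ∧ ω ^ 2 = g),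
    lam ς' / θ ς' ς'

/-- θ-twisted class functions on `G`, seen as functions on `Ĝ` supported on `G`. -/
def IsClassFn {Ghat : Type*} [Group Ghat] (π : Ghat →* ℤˣ)
    (θ : Ghat → Ghat → ℂ) (f : Ghat → ℂ) : Prop :=
  (∀ g : Ghat, π g ≠ 1 → f g = 0) ∧
    ∀ g h : Ghat, π g = 1 → π h = 1 →
      f (h * g * h⁻¹) = (θ (h * g * h⁻¹) h / θ h g) * f g

/-- A normalized `π`-twisted 2-cocycle with values in `ℂˣ`. -/
structure TwistedCocycle {Ghat : Type*} [Group Ghat] (π : Ghat →* ℤˣ) where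
  toFun : Ghat → Ghat → ℂˣ
  one_left : ∀ x, toFun 1 x = 1
  cocycle : ∀ x y z, toFun x y * toFun (x * y) z =
    toFun y z ^ ((π x : ℤˣ) : ℤ) * toFun x (y * z)

/-- The extension of `Ĝ` by `ℂˣ` classified by a twisted 2-cocycle. -/
@[ext]
structure TwistedExt {Ghat : Type*} [Group Ghat] {π : Ghat →* ℤˣ} (c : TwistedCocycle π) where
  coef : ℂˣ
  base : Ghat

namespace TwistedExt

variable {Ghat : Type*} [Group Ghat] {π : Ghat →* ℤˣ} {c : TwistedCocycle π}

instance : Mul (TwistedExt c) :=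
  ⟨fun x y => ⟨x.coef * y.coef ^ ((π x.base : ℤˣ) : ℤ) * c.toFun x.base y.base, x.base * y.base⟩⟩

instance : One (TwistedExt c) := ⟨⟨1, 1⟩⟩

instance : Inv (TwistedExt c) :=
  ⟨fun x => ⟨(x.coef ^ ((π x.base : ℤˣ) : ℤ) * c.toFun x.base⁻¹ x.base)⁻¹, x.base⁻¹⟩⟩

theorem mul_def (x y : TwistedExt c) : x * y =
    ⟨x.coef * y.coef ^ ((π x.base : ℤˣ) : ℤ) * c.toFun x.base y.base, x.base * y.base⟩ := rfl

theorem one_def : (1 : TwistedExt c) = ⟨1, 1⟩ := rfl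

theorem inv_def (x : TwistedExt c) : x⁻¹ =
    ⟨(x.coef ^ ((π x.base : ℤˣ) : ℤ) * c.toFun x.base⁻¹ x.base)⁻¹, x.base⁻¹⟩ := rfl

instance : Group (TwistedExt c) :=
  Group.ofLeftAxioms
    (fun x y z => by
      ext1
      · simp only [mul_def, map_mul, Units.val_mul, mul_zpow, zpow_mul']
        have h := c.cocycle x.base y.base z.base
        calc _ = x.coef * y.coef ^ ((π x.base : ℤˣ) : ℤ) *
              (z.coef ^ ((π y.base : ℤˣ) : ℤ)) ^ ((π x.base : ℤˣ) : ℤ) *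
              (c.toFun x.base y.base * c.toFun (x.base * y.base) z.base) := by
              rw [mul_right_comm (x.coef * _), mul_assoc]
          _ = _ := by rw [h]; simp only [mul_assoc]
      · exact mul_assoc _ _ _)
    (fun x => by ext1 <;> simp [mul_def, one_def, c.one_left])
    (fun x => by
      ext1
      · rcases Int.units_eq_one_or (π x.base) with h | h <;>
          simp [mul_def, one_def, inv_def, h]
      · simp [mul_def, one_def, inv_def])

@[simp] theorem base_mul (x y : TwistedExt c) : (x * y).base = x.base * y.base := rfl
@[simp] theorem base_inv (x : TwistedExt c) : x⁻¹.base = x.base⁻¹ := rfl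

/-- The set-theoretic section of the extension. -/
def sec (c : TwistedCocycle π) (g : Ghat) : TwistedExt c := ⟨1, g⟩

/-- The inclusion of the scalars into the extension. -/
def scal (c : TwistedCocycle π) (a : ℂˣ) : TwistedExt c := ⟨a, 1⟩

@[simp] theorem base_sec (g : Ghat) : (sec c g).base = g := rfl
@[simp] theorem base_scal (a : ℂˣ) : (scal c a).base = 1 := rfl

theorem scal_mul (a : ℂˣ) (x : TwistedExt c) : scal c a * x = ⟨a * x.coef, x.base⟩ := by
  ext1 <;> simp [mul_def, scal, c.one_left]

theorem scal_mul_scal (a b : ℂˣ) : scal c a * scal c b = scal c (a * b) := scal_mul _ _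

theorem scal_inv (a : ℂˣ) : (scal c a)⁻¹ = scal c a⁻¹ := by
  rw [inv_eq_iff_mul_eq_one, scal_mul_scal, mul_inv_cancel]; rfl

theorem eq_scal_mul_sec (x : TwistedExt c) : x = scal c x.coef * sec c x.base := by
  rw [scal_mul]; ext1 <;> simp [sec]

theorem sec_mul_sec (g h : Ghat) : sec c g * sec c h = scal c (c.toFun g h) * sec c (g * h) := by
  rw [scal_mul]; ext1 <;> simp [sec, mul_def]

theorem toFun_one_right (c : TwistedCocycle π) (x : Ghat) : c.toFun x 1 = 1 := by
  have h := congrArg coef (mul_one (sec c x))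
  simpa [mul_def, sec, one_def] using h

theorem mul_scal (a : ℂˣ) (x : TwistedExt c) :
    x * scal c a = scal c (a ^ ((π x.base : ℤˣ) : ℤ)) * x := by
  rw [scal_mul]
  ext1 <;> simp [mul_def, scal, toFun_one_right, mul_comm]

theorem mul_scal_of_pos {x : TwistedExt c} (hx : π x.base = 1) (a : ℂˣ) :
    x * scal c a = scal c a * x := by
  simp [mul_scal, hx]

theorem mul_scal_of_neg {x : TwistedExt c} (hx : π x.base = -1) (a : ℂˣ) :
    x * scal c a = scal c a⁻¹ * x := by
  simp [mul_scal, hx]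

theorem scal_mul_inv_sq {x : TwistedExt c} (hx : π x.base = -1) (a : ℂˣ) :
    (scal c a * x)⁻¹ * (scal c a * x)⁻¹ = x⁻¹ * x⁻¹ := by
  have h : π x⁻¹.base = -1 := by simp [hx]
  rw [mul_inv_rev, scal_inv, mul_scal_of_neg h, inv_inv, mul_assoc, ← mul_assoc x⁻¹,
    mul_scal_of_neg h, ← mul_assoc, ← mul_assoc, scal_mul_scal, mul_inv_cancel]
  exact congrArg (· * x⁻¹) (one_mul _)

theorem conj_scal_mul_inv {t x : TwistedExt c} (ht : π t.base = -1) (hx : π x.base = 1)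
    (a : ℂˣ) : t * (scal c a * x)⁻¹ * t⁻¹ = scal c a * (t * x⁻¹ * t⁻¹) := by
  have h : π x⁻¹.base = 1 := by simp [hx]
  rw [mul_inv_rev, scal_inv, mul_scal_of_pos h, ← mul_assoc, mul_scal_of_neg ht, inv_inv]
  simp only [mul_assoc]

theorem sec_conj_sec_inv {s : Ghat} (hs : π s = -1) (g : Ghat) :
    sec c s * (sec c g)⁻¹ * (sec c s)⁻¹ =
      scal c (c.toFun g⁻¹ g * (c.toFun s g⁻¹ / c.toFun (s * g⁻¹ * s⁻¹) s)) *
        sec c (s * g⁻¹ * s⁻¹) := by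
  rw [mul_inv_eq_iff_eq_mul, scal_mul]
  ext1
  · simp [mul_def, inv_def, sec, hs, mul_assoc]
  · simp

section Rep

variable {V : Type*} [AddCommGroup V] [Module ℂ V]

/-- The operator by which an element of the extension acts on a twisted representation. -/
noncomputable def act (ρ : Ghat → V →ₗ[ℂ] V) (x : TwistedExt c) : V →ₗ[ℂ] V :=
  (x.coef : ℂ) • ρ x.base

/-- `ρ` is a twisted representation of `ker π`. -/
def IsTwistedRep (c : TwistedCocycle π) (ρ : Ghat → V →ₗ[ℂ] V) : Prop :=
  ∀ g h, π g = 1 → π h = 1 → ρ g ∘ₗ ρ h = (c.toFun g h : ℂ) • ρ (g * h)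

variable {ρ : Ghat → V →ₗ[ℂ] V}

theorem act_sec (g : Ghat) : act ρ (sec c g) = ρ g := by simp [act, sec]

theorem act_scal_mul (a : ℂˣ) (x : TwistedExt c) :
    act ρ (scal c a * x) = (a : ℂ) • act ρ x := by
  simp [act, scal_mul, mul_smul]

theorem act_mul (hρ : IsTwistedRep c ρ) {x y : TwistedExt c} (hx : π x.base = 1)
    (hy : π y.base = 1) : act ρ (x * y) = act ρ x ∘ₗ act ρ y := by
  simp [act, LinearMap.comp_smul, LinearMap.smul_comp, hρ _ _ hx hy, smul_smul, mul_def, hx]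
  congr 1; ring

/-- The action of the extension on the twisted dual. -/
noncomputable def dualAct (lam : Ghat →* ℂ) (ρ : Ghat → V →ₗ[ℂ] V) (t x : TwistedExt c) :
    Module.Dual ℂ V →ₗ[ℂ] Module.Dual ℂ V :=
  lam x.base • (act ρ (t * x⁻¹ * t⁻¹)).dualMap

theorem dualAct_mul (hρ : IsTwistedRep c ρ) (lam : Ghat →* ℂ) (t : TwistedExt c)
    {x y : TwistedExt c} (hx : π x.base = 1) (hy : π y.base = 1) :
    dualAct lam ρ t (x * y) = dualAct lam ρ t x ∘ₗ dualAct lam ρ t y := by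
  have h : t * (x * y)⁻¹ * t⁻¹ = (t * y⁻¹ * t⁻¹) * (t * x⁻¹ * t⁻¹) := by group
  rw [dualAct, h, act_mul hρ (by simp [hy]) (by simp [hx])]
  ext f v
  simp [dualAct, mul_assoc]

/-- The summand of the averaging operator producing intertwiners to the twisted dual. -/
noncomputable def avgTerm (lam : Ghat →* ℂ) (ρ : Ghat → V →ₗ[ℂ] V) (t : TwistedExt c)
    (B : V →ₗ[ℂ] Module.Dual ℂ V) (x : TwistedExt c) : V →ₗ[ℂ] Module.Dual ℂ V :=
  dualAct lam ρ t x ∘ₗ B ∘ₗ act ρ x⁻¹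

theorem avgTerm_eq_sec (lam : Ghat →* ℂ) {t : TwistedExt c} (ht : π t.base = -1)
    (B : V →ₗ[ℂ] Module.Dual ℂ V) {x : TwistedExt c} (hx : π x.base = 1) :
    avgTerm lam ρ t B x = avgTerm lam ρ t B (sec c x.base) := by
  have h : π (sec c x.base)⁻¹.base = 1 := by simp [hx]
  have h1 : x⁻¹ = scal c x.coef⁻¹ * (sec c x.base)⁻¹ := by
    conv_lhs => rw [eq_scal_mul_sec x]
    rw [mul_inv_rev, scal_inv, mul_scal_of_pos h]
  have h2 : t * x⁻¹ * t⁻¹ = scal c x.coef * (t * (sec c x.base)⁻¹ * t⁻¹) := by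
    rw [← conj_scal_mul_inv ht (x := sec c x.base) hx, ← eq_scal_mul_sec]
  have h3 : dualAct lam ρ t x = (x.coef : ℂ) • dualAct lam ρ t (sec c x.base) := by
    rw [dualAct, dualAct, h2, act_scal_mul, smul_comm, base_sec]
    congr 1
    ext f v
    simp
  have h4 : act ρ x⁻¹ = (x.coef : ℂ)⁻¹ • act ρ (sec c x.base)⁻¹ := by
    rw [h1, act_scal_mul, Units.val_inv_eq_inv_val]
  rw [avgTerm, avgTerm, h3, h4, LinearMap.comp_smul, LinearMap.comp_smul, LinearMap.smul_comp,
    smul_smul, inv_mul_cancel₀ x.coef.ne_zero, one_smul]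

variable [Fintype Ghat]

/-- The average of `B` over `ker π`. -/
noncomputable def avg (lam : Ghat →* ℂ) (ρ : Ghat → V →ₗ[ℂ] V) (t : TwistedExt c)
    (B : V →ₗ[ℂ] Module.Dual ℂ V) : V →ₗ[ℂ] Module.Dual ℂ V :=
  ∑ h ∈ Finset.univ.filter (fun h : Ghat => π h = 1), avgTerm lam ρ t B (sec c h)

theorem avg_comp (hρ : IsTwistedRep c ρ) (lam : Ghat →* ℂ) {t : TwistedExt c}
    (ht : π t.base = -1) (B : V →ₗ[ℂ] Module.Dual ℂ V) {g : Ghat} (hg : π g = 1) :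
    avg lam ρ t B ∘ₗ ρ g = dualAct lam ρ t (sec c g) ∘ₗ avg lam ρ t B := by
  have key : ∀ h, π h = 1 → avgTerm lam ρ t B (sec c h) ∘ₗ ρ g =
      dualAct lam ρ t (sec c g) ∘ₗ avgTerm lam ρ t B (sec c (g⁻¹ * h)) := by
    intro h hh
    have hx : π ((sec c g)⁻¹ * sec c h).base = 1 := by simp [hg, hh]
    have e := avgTerm_eq_sec (ρ := ρ) lam ht B hx
    simp only [base_mul, base_inv, base_sec] at e
    rw [← e, avgTerm, avgTerm,
      ← LinearMap.comp_assoc _ (dualAct lam ρ t ((sec c g)⁻¹ * sec c h)),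
      ← dualAct_mul hρ lam t (by simpa using hg) hx, mul_inv_cancel_left, mul_inv_rev, inv_inv,
      act_mul hρ (by simp [hh]) (by simpa using hg), act_sec]
    rfl
  have e1 : avg lam ρ t B ∘ₗ ρ g = ∑ h ∈ Finset.univ.filter (fun h : Ghat => π h = 1),
      avgTerm lam ρ t B (sec c h) ∘ₗ ρ g := by
    ext v w; simp [avg]
  have e2 : dualAct lam ρ t (sec c g) ∘ₗ avg lam ρ t B =
      ∑ h ∈ Finset.univ.filter (fun h : Ghat => π h = 1),
        dualAct lam ρ t (sec c g) ∘ₗ avgTerm lam ρ t B (sec c h) := by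
    ext v w; simp [avg]
  rw [e1, e2]
  refine Finset.sum_equiv (Equiv.mulLeft g⁻¹) (fun h => by simp [hg]) fun h hh => ?_
  exact key h (by simpa using hh)

theorem sum_trace_eq_zero {V ι : Type*} [AddCommGroup V] [Module ℂ V] [FiniteDimensional ℂ V]
    (s : Finset ι) (X Y : ι → V →ₗ[ℂ] V) (A : V →ₗ[ℂ] V)
    (h : ∀ (φ ψ : Module.Dual ℂ V) (v w : V), ∑ i ∈ s, φ (X i v) * ψ (Y i w) = 0) :
    ∑ i ∈ s, LinearMap.trace ℂ V (X i ∘ₗ A ∘ₗ Y i) = 0 := by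
  let b := Module.finBasis ℂ V
  have e : ∀ i, LinearMap.trace ℂ V (X i ∘ₗ A ∘ₗ Y i) =
      ∑ k, ∑ l, b.coord k (X i (b l)) * (b.coord l ∘ₗ A) (Y i (b k)) := by
    intro i
    rw [LinearMap.trace_eq_matrix_trace ℂ b, Matrix.trace]
    refine Finset.sum_congr rfl fun k _ => ?_
    have h1 : (X i) (A (Y i (b k))) = ∑ l, b.coord l (A (Y i (b k))) • X i (b l) := by
      conv_lhs => rw [← b.sum_repr (A (Y i (b k))), map_sum]
      simp
    rw [Matrix.diag_apply, LinearMap.toMatrix_apply]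
    simp only [LinearMap.comp_apply]
    rw [h1, ← b.coord_apply, map_sum]
    simp [mul_comm]
  simp_rw [e]
  rw [Finset.sum_comm]
  refine Finset.sum_eq_zero fun k _ => ?_
  rw [Finset.sum_comm]
  exact Finset.sum_eq_zero fun l _ => h _ _ _ _

/-- If every average vanishes, then so does the Frobenius–Schur sum. -/
theorem sum_trace_inv_sq_eq_zero [FiniteDimensional ℂ V] (hρ : IsTwistedRep c ρ)
    (lam : Ghat →* ℂ) {s : Ghat} (hs : π s = -1)
    (havg : ∀ B, avg lam ρ (sec c s) B = 0) :
    ∑ ω ∈ Finset.univ.filter (fun ω : Ghat => π ω = -1),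
      lam ω * LinearMap.trace ℂ V (act ρ ((sec c ω)⁻¹ * (sec c ω)⁻¹)) = 0 := by
  set t := sec c s with ht
  have hts : π t.base = -1 := hs
  have e : ∑ ω ∈ Finset.univ.filter (fun ω : Ghat => π ω = -1),
      lam ω * LinearMap.trace ℂ V (act ρ ((sec c ω)⁻¹ * (sec c ω)⁻¹)) =
      ∑ h ∈ Finset.univ.filter (fun h : Ghat => π h = 1),
        LinearMap.trace ℂ V ((lam (s * h) • act ρ (sec c h)⁻¹) ∘ₗ act ρ (t⁻¹ * t⁻¹) ∘ₗ
          act ρ (t * (sec c h)⁻¹ * t⁻¹)) := by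
    symm
    refine Finset.sum_equiv (Equiv.mulLeft s) (fun h => by simp [hs]) fun h hh => ?_
    have hh : π h = 1 := by simpa using hh
    have hsh : π (sec c (s * h)).base = -1 := by simp [hs, hh]
    rw [Equiv.coe_mulLeft, ← scal_mul_inv_sq hsh (c.toFun s h), ← sec_mul_sec,
      LinearMap.smul_comp, map_smul, smul_eq_mul,
      ← act_mul hρ (by simp) (by simp [hh]),
      ← act_mul hρ (by simp [hh]) (by simp [hh])]
    congr 3
    rw [← ht]
    group
  rw [e]
  refine sum_trace_eq_zero _ _ _ _ fun φ ψ v w => ?_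
  have h := LinearMap.congr_fun (LinearMap.congr_fun (havg (φ.smulRight ψ)) v) w
  simp only [avg, avgTerm, dualAct, LinearMap.sum_apply, LinearMap.comp_apply,
    LinearMap.smulRight_apply, LinearMap.smul_apply, map_smul, LinearMap.dualMap_apply,
    smul_eq_mul, LinearMap.zero_apply, base_sec] at h
  calc _ = lam s * ∑ h ∈ Finset.univ.filter (fun h : Ghat => π h = 1),
        φ (act ρ (sec c h)⁻¹ v) * (lam h * ψ (act ρ (t * (sec c h)⁻¹ * t⁻¹) w)) := by
        rw [Finset.mul_sum]
        refine Finset.sum_congr rfl fun h _ => ?_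
        simp
        ring
    _ = 0 := by rw [h, mul_zero]

end Rep

end TwistedExt

open TwistedExt

theorem nuFun_isClassFn {Ghat : Type*} [Group Ghat] [Fintype Ghat] [DecidableEq Ghat]
    {π : Ghat →* ℤˣ} (c : TwistedCocycle π) (lam : Ghat →* ℂ) :
    IsClassFn π (fun x y => (c.toFun x y : ℂ)) (nuFun π (fun x y => (c.toFun x y : ℂ)) lam) := by
  refine ⟨fun g hg => ?_, fun g h _ hh => ?_⟩
  · rw [nuFun, Finset.filter_false_of_mem, Finset.sum_empty]
    rintro ω - ⟨hω, rfl⟩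
    exact hg (by simp [hω])
  · rw [nuFun, nuFun, Finset.mul_sum]
    symm
    refine Finset.sum_equiv (MulAut.conj h).toEquiv (fun ω => ?_) fun ω hω => ?_
    · simp [hh, conj_pow]
    · obtain ⟨hω', rfl⟩ : π ω = -1 ∧ ω ^ 2 = g := by simpa using hω
      have hlam : lam (h * ω * h⁻¹) = lam ω := by
        rw [map_mul, map_mul, mul_right_comm, ← map_mul]; simp
      have key : c.toFun (h * ω ^ 2 * h⁻¹) h * c.toFun (h * ω * h⁻¹) (h * ω * h⁻¹) =
          c.toFun h (ω ^ 2) * c.toFun ω ω := by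
        have hconj : π (sec c (h * ω * h⁻¹)).base = -1 := by simp [hω', hh]
        have e1 : sec c h * sec c ω * (sec c h)⁻¹ =
            scal c (sec c h * sec c ω * (sec c h)⁻¹).coef * sec c (h * ω * h⁻¹) :=
          eq_scal_mul_sec _
        have e2 := scal_mul_inv_sq hconj (sec c h * sec c ω * (sec c h)⁻¹).coef
        rw [← e1, ← mul_inv_rev, ← mul_inv_rev, inv_inj] at e2
        have e3 : sec c h * (sec c ω * sec c ω) =
            sec c (h * ω * h⁻¹) * sec c (h * ω * h⁻¹) * sec c h := by
          rw [← e2]; group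
        have e4 := congrArg coef e3
        simp [mul_def, sec, hh] at e4
        rw [mul_comm, pow_two, mul_comm (c.toFun h _), e4]
      have key' := congrArg (fun u : ℂˣ => (u : ℂ)) key
      simp only [Units.val_mul] at key'
      simp only [MulEquiv.toEquiv_eq_coe, MulEquiv.coe_toEquiv, MulAut.conj_apply, hlam]
      have := (c.toFun h (ω ^ 2)).ne_zero
      have := (c.toFun ω ω).ne_zero
      have := (c.toFun (h * ω * h⁻¹) (h * ω * h⁻¹)).ne_zero
      field_simp
      linear_combination (lam ω) * key'

theorem rhoP_eq_dualAct {Ghat V : Type*} [Group Ghat] [AddCommGroup V] [Module ℂ V]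
    {π : Ghat →* ℤˣ} (c : TwistedCocycle π) (lam : Ghat →* ℂ) (ρ : Ghat → V ≃ₗ[ℂ] V)
    {s : Ghat} (hs : π s = -1) (g : Ghat) :
    rhoP π (fun x y => (c.toFun x y : ℂ)) lam ρ s g =
      dualAct lam (fun g => (ρ g).toLinearMap) (sec c s) (sec c g) := by
  rw [dualAct, sec_conj_sec_inv hs, act_scal_mul, act_sec, rhoP, taurefl]
  ext f v
  simp [hs]
  field_simp

theorem pairG_chiFun_nuFun {Ghat V : Type*} [Group Ghat] [Fintype Ghat] [DecidableEq Ghat]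
    [AddCommGroup V] [Module ℂ V] {π : Ghat →* ℤˣ} (c : TwistedCocycle π) (lam : Ghat →* ℂ)
    (ρ : Ghat → V ≃ₗ[ℂ] V) :
    pairG π (fun x y => (c.toFun x y : ℂ)) (chiFun π ρ)
        (nuFun π (fun x y => (c.toFun x y : ℂ)) lam) =
      (↑(Finset.univ.filter fun g : Ghat => π g = 1).card)⁻¹ *
        ∑ ω ∈ Finset.univ.filter (fun ω : Ghat => π ω = -1), lam ω * LinearMap.trace ℂ V
          (act (fun g => (ρ g).toLinearMap) ((sec c ω)⁻¹ * (sec c ω)⁻¹)) := by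
  rw [pairG]
  congr 1
  rw [← Finset.sum_fiberwise_of_maps_to (s := Finset.univ.filter (fun ω : Ghat => π ω = -1))
    (t := Finset.univ.filter (fun g : Ghat => π g = 1)) (g := fun ω => ω ^ 2)
    (fun ω hω => by simp_all)]
  refine Finset.sum_congr rfl fun g hg => ?_
  rw [nuFun, Finset.mul_sum, Finset.filter_filter]
  refine Finset.sum_congr rfl fun ω hω => ?_
  obtain ⟨-, rfl⟩ : π ω = -1 ∧ ω ^ 2 = g := by simpa using hω
  have hp : π ((sec c (ω ^ 2))⁻¹).base = 1 := by simp
  have e : (sec c ω)⁻¹ * (sec c ω)⁻¹ =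
      scal c ((c.toFun ω ω)⁻¹ * (c.toFun (ω ^ 2)⁻¹ (ω ^ 2))⁻¹) * sec c (ω ^ 2)⁻¹ := by
    rw [← mul_inv_rev, sec_mul_sec, mul_inv_rev, ← pow_two, scal_inv, mul_scal_of_pos hp,
      ← scal_mul_scal, mul_assoc]
    congr 1
    rw [scal_mul]
    ext1 <;> simp [inv_def, sec]
  rw [e, act_scal_mul, act_sec]
  simp [chiFun]
  ring

/-- A nonzero intertwiner from an irreducible representation to its twisted dual
is an isomorphism. -/
theorem exists_equiv_of_intertwiner {Ghat V : Type*} [Group Ghat] [AddCommGroup V] [Module ℂ V]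
    [FiniteDimensional ℂ V] {π : Ghat →* ℤˣ} {ρ : Ghat → V ≃ₗ[ℂ] V}
    (hirr : ∀ U : Submodule ℂ V,
      (∀ g : Ghat, π g = 1 → ∀ v ∈ U, ρ g v ∈ U) → U = ⊥ ∨ U = ⊤)
    {σ : Ghat → Module.Dual ℂ V →ₗ[ℂ] Module.Dual ℂ V} {T : V →ₗ[ℂ] Module.Dual ℂ V}
    (hT : ∀ g, π g = 1 → T ∘ₗ (ρ g).toLinearMap = σ g ∘ₗ T) (hne : T ≠ 0) :
    ∃ ψ : V ≃ₗ[ℂ] Module.Dual ℂ V, ∀ g, π g = 1 →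
      ψ.toLinearMap ∘ₗ (ρ g).toLinearMap = σ g ∘ₗ ψ.toLinearMap := by
  have hker : LinearMap.ker T = ⊥ := by
    refine (hirr (LinearMap.ker T) fun g hg v hv => ?_).resolve_right
      fun h => hne (LinearMap.ker_eq_top.mp h)
    have h := LinearMap.congr_fun (hT g hg) v
    rw [LinearMap.mem_ker] at hv ⊢
    simpa [hv] using h
  refine ⟨T.linearEquivOfInjective (LinearMap.ker_eq_bot.mp hker)
    Subspace.dual_finrank_eq.symm, fun g hg => ?_⟩
  exact hT g hg

open scoped Classical in
/-- Corollary 2.11 of the paper. If the characters of a finite family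
of irreducible θ-twisted representations form an orthonormal basis of the space of
θ-twisted class functions, then `ν = Σ_{i : P(V_i) ≅ V_i} ⟨χ_i,ν⟩_G χ_i` as functions on
`G`. -/
theorem stmt10 {Ghat : Type*} [Group Ghat] [Fintype Ghat] [DecidableEq Ghat]
    (π : Ghat →* ℤˣ) (hπ : Function.Surjective π)
    (θ : Ghat → Ghat → ℂ)
    (hnorm : ∀ a b : Ghat, ‖θ a b‖ = 1)
    (hθe : ∀ ω : Ghat, θ ω 1 = 1) (hθe' : ∀ ω : Ghat, θ 1 ω = 1)
    (hcoc : ∀ ω₃ ω₂ ω₁ : Ghat, θ ω₃ ω₂ * θ (ω₃ * ω₂) ω₁ =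
      θ ω₂ ω₁ ^ ((π ω₃ : ℤˣ) : ℤ) * θ ω₃ (ω₂ * ω₁))
    (lam : Ghat →* ℂ) (hlam : ∀ ω : Ghat, ‖lam ω‖ = 1)
    (ς : Ghat) (hς : π ς = -1)
    {I : Type*} [Fintype I]
    (V : I → Type*) [∀ i, AddCommGroup (V i)] [∀ i, Module ℂ (V i)]
    [∀ i, FiniteDimensional ℂ (V i)] [∀ i, Nontrivial (V i)]
    (ρ : ∀ i, Ghat → (V i ≃ₗ[ℂ] V i))
    (hρe : ∀ i, ρ i 1 = LinearEquiv.refl ℂ (V i))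
    (hρ : ∀ i, ∀ g₂ g₁ : Ghat, π g₂ = 1 → π g₁ = 1 →
      (ρ i g₂).toLinearMap ∘ₗ (ρ i g₁).toLinearMap =
        θ g₂ g₁ • (ρ i (g₂ * g₁)).toLinearMap)
    (hirr : ∀ i, ∀ U : Submodule ℂ (V i),
      (∀ g : Ghat, π g = 1 → ∀ v ∈ U, ρ i g v ∈ U) → U = ⊥ ∨ U = ⊤)
    -- the characters are θ-twisted class functions
    (hclass : ∀ i, IsClassFn π θ (chiFun π (ρ i)))
    -- orthonormality
    (horth : ∀ i j, pairG π θ (chiFun π (ρ i)) (chiFun π (ρ j)) =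
      if i = j then 1 else 0)
    -- spanning: every θ-twisted class function is a linear combination of characters
    (hspan : ∀ f : Ghat → ℂ, IsClassFn π θ f →
      ∃ c : I → ℂ, f = fun g => ∑ i, c i * chiFun π (ρ i) g) :
    ∀ g : Ghat, π g = 1 →
      nuFun π θ lam g =
        ∑ i ∈ Finset.univ.filter (fun i =>
            ∃ ψ : V i ≃ₗ[ℂ] Module.Dual ℂ (V i), ∀ g' : Ghat, π g' = 1 →
              ψ.toLinearMap ∘ₗ (ρ i g').toLinearMap =
                rhoP π θ lam (ρ i) ς g' ∘ₗ ψ.toLinearMap),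
          pairG π θ (chiFun π (ρ i)) (nuFun π θ lam) * chiFun π (ρ i) g := by
  have hne : ∀ a b, θ a b ≠ 0 := fun a b h => by simpa [h] using hnorm a b
  obtain ⟨c, rfl⟩ : ∃ c : TwistedCocycle π, θ = fun x y => (c.toFun x y : ℂ) :=
    ⟨⟨fun x y => Units.mk0 (θ x y) (hne x y), fun x => Units.ext (hθe' x),
      fun x y z => Units.ext (by simpa using hcoc x y z)⟩, rfl⟩
  have hvanish : ∀ i, (¬ ∃ ψ : V i ≃ₗ[ℂ] Module.Dual ℂ (V i), ∀ g' : Ghat, π g' = 1 →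
      ψ.toLinearMap ∘ₗ (ρ i g').toLinearMap =
        rhoP π (fun x y => (c.toFun x y : ℂ)) lam (ρ i) ς g' ∘ₗ ψ.toLinearMap) →
      pairG π (fun x y => (c.toFun x y : ℂ)) (chiFun π (ρ i))
        (nuFun π (fun x y => (c.toFun x y : ℂ)) lam) = 0 := by
    intro i hi
    rw [pairG_chiFun_nuFun, sum_trace_inv_sq_eq_zero (hρ i) lam hς, mul_zero]
    intro B
    by_contra hB
    refine hi (exists_equiv_of_intertwiner (hirr i) (fun g hg => ?_) hB)
    rw [rhoP_eq_dualAct c lam (ρ i) hς]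
    exact avg_comp (hρ i) lam hς B hg
  obtain ⟨a, ha⟩ := hspan _ (nuFun_isClassFn c lam)
  have hcoef : ∀ i, pairG π (fun x y => (c.toFun x y : ℂ)) (chiFun π (ρ i))
      (nuFun π (fun x y => (c.toFun x y : ℂ)) lam) = a i := by
    intro i
    rw [ha]
    calc _ = ∑ j, a j * pairG π (fun x y => (c.toFun x y : ℂ)) (chiFun π (ρ i))
          (chiFun π (ρ j)) := by
          simp only [pairG, Finset.mul_sum]
          rw [Finset.sum_comm]
          refine Finset.sum_congr rfl fun j _ => Finset.sum_congr rfl fun g _ => ?_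
          ring
      _ = a i := by simp [horth]
  intro g _
  rw [Finset.sum_filter_of_ne]
  · simp_rw [hcoef]
    exact congrFun ha g
  · intro i _ h
    by_contra hi
    exact h (by rw [hvanish i hi, zero_mul])
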